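/- Time-dependent-kernel representation of the Liouville-evolved SWT (free case): let ε > 0, σ_x > 0, σ_k > 0, let u₀ : ℝ → ℂ be Schwartz, and let u : ℝ × ℝ → ℂ be a smooth solution of the free Schrödinger equation ε ∂_t u = i(ε²/2) ∂²_x u with u(·,0) = u₀, Schwartz in x for each t with seminorms locally bounded in t. Let w̃(x,k,t) be the solution of the free Liouville equation ∂_t w̃ + 2πk ∂_x w̃ = 0 with initial data w̃(x,k,0) = W̃^{σ_x,σ_k;ε}[u₀](x,k), i.e. w̃(x,k,t) = W̃^{σ_x,σ_k;ε}[u₀](x − 2πkt, k). Then for all (x,k,t): w̃(x,k,t) = ∫∫_{ℝ²} G_ε((x−z) − 2π(k−y)t, k−y) · W^ε[u(·,t)](z,y) dz dy, where G_ε(x,k) = (2/(ε σ_x σ_k)) exp(−2πx²/(ε σ_x²) − 2πk²/(ε σ_k²)); that is, the Liouville-evolved SWT equals the Wigner transform of the true solution at time t, smoothed with the kernel G_ε composed with the free Hamiltonian flow φ_t(x,k) = (x − 2πkt, k). -/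

import Mathlib

open Real MeasureTheory

/-- The scaled Wigner transform `W^ε[f,g](x,k) = ∫ e^{-2πiky} f(x+εy/2) conj(g(x-εy/2)) dy`. -/
noncomputable def wigner (ε : ℝ) (f g : ℝ → ℂ) (x k : ℝ) : ℂ :=
  ∫ y : ℝ, Complex.exp (-(2 * π * Complex.I * k * y)) *
    f (x + ε * y / 2) * (starRingEnd ℂ) (g (x - ε * y / 2))

/-- The normalized Gaussian smoothing kernel
`G_ε(x,k) = (2/(ε σx σk)) exp(-2πx²/(ε σx²) - 2πk²/(ε σk²))`. -/
noncomputable def gKer (ε σx σk : ℝ) (x k : ℝ) : ℝ :=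
  2 / (ε * σx * σk) * Real.exp (-(2 * π * x ^ 2 / (ε * σx ^ 2)) - 2 * π * k ^ 2 / (ε * σk ^ 2))

/-- The smoothed Wigner transform `W̃^{σx,σk;ε}[f,g] = G_ε * W^ε[f,g]` (convolution in phase
space). -/
noncomputable def swt (ε σx σk : ℝ) (f g : ℝ → ℂ) (x k : ℝ) : ℂ :=
  ∫ x' : ℝ, ∫ k' : ℝ, (gKer ε σx σk (x - x') (k - k') : ℂ) * wigner ε f g x' k'


lemma prod_bound {a b A B C : ℝ} (hA : A * (1 + a ^ 2) ≤ C) (hB : B * (1 + b ^ 2) ≤ C)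
    (hA0 : 0 ≤ A) (hB0 : 0 ≤ B) : A * B ≤ 2 * C ^ 2 * (1 + (a - b) ^ 2)⁻¹ := by
  have hC : 0 ≤ C := le_trans (by positivity) hA
  rw [← div_eq_mul_inv, le_div_iff₀ (by positivity)]
  have h1 : (A * (1 + a ^ 2)) * (B * (1 + b ^ 2)) ≤ C * C :=
    mul_le_mul hA hB (by positivity) hC
  have h2 : (1 + (a - b) ^ 2) ≤ 2 * ((1 + a ^ 2) * (1 + b ^ 2)) := by
    nlinarith [sq_nonneg (a + b), sq_nonneg (a * b)]
  have h3 : A * B * (1 + (a - b) ^ 2) ≤ A * B * (2 * ((1 + a ^ 2) * (1 + b ^ 2))) :=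
    mul_le_mul_of_nonneg_left h2 (by positivity)
  nlinarith

lemma integrable_bd (ε : ℝ) (hε : 0 < ε) : Integrable (fun y : ℝ => (1 + (ε * y) ^ 2)⁻¹) :=
  integrable_inv_one_add_sq.comp_mul_left' hε.ne'

lemma norm_ph (k y : ℝ) : ‖Complex.exp (-(2 * π * Complex.I * k * y))‖ = 1 := by
  have : -(2 * π * Complex.I * k * y) = ((-(2 * π * k * y) : ℝ) : ℂ) * Complex.I := by
    push_cast; ring
  rw [this, Complex.norm_exp_ofReal_mul_I]

lemma term_bound {f g : ℝ → ℂ} {C : ℝ} (ε x y k : ℝ) (hf : ∀ x, ‖f x‖ * (1 + x ^ 2) ≤ C)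
    (hg : ∀ x, ‖g x‖ * (1 + x ^ 2) ≤ C) :
    ‖Complex.exp (-(2 * π * Complex.I * k * y)) *
      f (x + ε * y / 2) * (starRingEnd ℂ) (g (x - ε * y / 2))‖ ≤
      2 * C ^ 2 * (1 + (ε * y) ^ 2)⁻¹ := by
  rw [norm_mul, norm_mul, norm_ph, one_mul, RCLike.norm_conj]
  have := prod_bound (hf (x + ε * y / 2)) (hg (x - ε * y / 2)) (norm_nonneg _) (norm_nonneg _)
  convert this using 4
  ring

lemma cont_ph (k : ℝ) : Continuous (fun y : ℝ => Complex.exp (-(2 * π * Complex.I * k * y))) := by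
  fun_prop

lemma cont_term {f g : ℝ → ℂ} (hf : Continuous f) (hg : Continuous g) (ε x k : ℝ) :
    Continuous (fun y : ℝ => Complex.exp (-(2 * π * Complex.I * k * y)) *
      f (x + ε * y / 2) * (starRingEnd ℂ) (g (x - ε * y / 2))) := by
  have h1 : Continuous (fun y : ℝ => f (x + ε * y / 2)) := hf.comp (by fun_prop)
  have h2 : Continuous (fun y : ℝ => (starRingEnd ℂ) (g (x - ε * y / 2))) :=
    Complex.continuous_conj.comp (hg.comp (by fun_prop))
  exact ((cont_ph k).mul h1).mul h2

lemma int_term {f g : ℝ → ℂ} {C : ℝ} (ε x k : ℝ) (hε : 0 < ε) (hfc : Continuous f)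
    (hgc : Continuous g) (hf : ∀ x, ‖f x‖ * (1 + x ^ 2) ≤ C)
    (hg : ∀ x, ‖g x‖ * (1 + x ^ 2) ≤ C) :
    Integrable (fun y : ℝ => Complex.exp (-(2 * π * Complex.I * k * y)) *
      f (x + ε * y / 2) * (starRingEnd ℂ) (g (x - ε * y / 2))) :=
  ((integrable_bd ε hε).const_mul (2 * C ^ 2)).mono' (cont_term hfc hgc ε x k).aestronglyMeasurable
    (Filter.Eventually.of_forall fun y => term_bound ε x y k hf hg)

lemma wigner_bound {f g : ℝ → ℂ} {C : ℝ} (ε x k : ℝ) (hε : 0 < ε)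
    (hf : ∀ x, ‖f x‖ * (1 + x ^ 2) ≤ C) (hg : ∀ x, ‖g x‖ * (1 + x ^ 2) ≤ C) :
    ‖wigner ε f g x k‖ ≤ ∫ y : ℝ, 2 * C ^ 2 * (1 + (ε * y) ^ 2)⁻¹ :=
  norm_integral_le_of_norm_le ((integrable_bd ε hε).const_mul (2 * C ^ 2))
    (Filter.Eventually.of_forall fun y => term_bound ε x y k hf hg)

lemma wigner_meas {f g : ℝ → ℂ} (ε : ℝ) (hf : Continuous f) (hg : Continuous g) :
    StronglyMeasurable (fun p : ℝ × ℝ => wigner ε f g p.1 p.2) := by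
  have h : Continuous (fun q : (ℝ × ℝ) × ℝ => Complex.exp (-(2 * π * Complex.I * q.1.2 * q.2)) *
      f (q.1.1 + ε * q.2 / 2) * (starRingEnd ℂ) (g (q.1.1 - ε * q.2 / 2))) := by
    have h0 : Continuous (fun q : (ℝ × ℝ) × ℝ =>
      Complex.exp (-(2 * π * Complex.I * q.1.2 * q.2))) := by fun_prop
    have h1 : Continuous (fun q : (ℝ × ℝ) × ℝ => f (q.1.1 + ε * q.2 / 2)) :=
      hf.comp (by fun_prop)
    have h2 : Continuous (fun q : (ℝ × ℝ) × ℝ => (starRingEnd ℂ) (g (q.1.1 - ε * q.2 / 2))) :=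
      Complex.continuous_conj.comp (hg.comp (by fun_prop))
    exact (h0.mul h1).mul h2
  exact h.stronglyMeasurable.integral_prod_right (f := fun (p : ℝ × ℝ) (y : ℝ) => Complex.exp (-(2 * π * Complex.I * p.2 * y)) *
      f (p.1 + ε * y / 2) * (starRingEnd ℂ) (g (p.1 - ε * y / 2)))

/-- The integrand of the Wigner transform. -/
noncomputable def bt (ε k : ℝ) (f g : ℝ → ℂ) (x y : ℝ) : ℂ :=
  Complex.exp (-(2 * π * Complex.I * k * y)) *
      f (x + ε * y / 2) * (starRingEnd ℂ) (g (x - ε * y / 2))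

lemma bt_cont (f g : ℝ → ℂ) (hf : Continuous f) (hg : Continuous g) (ε x k : ℝ) :
    Continuous (bt ε k f g x) := cont_term hf hg ε x k

lemma bt_bound (f g : ℝ → ℂ) {C : ℝ} (ε x y k : ℝ) (hf : ∀ x, ‖f x‖ * (1 + x ^ 2) ≤ C)
    (hg : ∀ x, ‖g x‖ * (1 + x ^ 2) ≤ C) :
    ‖bt ε k f g x y‖ ≤ 2 * C ^ 2 * (1 + (ε * y) ^ 2)⁻¹ := term_bound ε x y k hf hg

lemma bt_int (f g : ℝ → ℂ) {C : ℝ} (ε x k : ℝ) (hε : 0 < ε) (hfc : Continuous f)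
    (hgc : Continuous g) (hf : ∀ x, ‖f x‖ * (1 + x ^ 2) ≤ C)
    (hg : ∀ x, ‖g x‖ * (1 + x ^ 2) ≤ C) :
    Integrable (bt ε k f g x) := int_term ε x k hε hfc hgc hf hg

lemma wigner_transport (ε : ℝ) (hε : 0 < ε) (u u1 u2 : ℝ → ℝ → ℂ)
    (hx : ∀ x t, HasDerivAt (fun x' => u x' t) (u1 x t) x)
    (hx1 : ∀ x t, HasDerivAt (fun x' => u1 x' t) (u2 x t) x)
    (hc2 : ∀ t, Continuous (fun x' => u2 x' t))
    (ht : ∀ a b s : ℝ, HasDerivAt (fun s => u (a + b * s) s)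
      (b * u1 (a + b * s) s + Complex.I * ε / 2 * u2 (a + b * s) s) s)
    (hb : ∀ T : ℝ, ∃ C : ℝ, ∀ t x : ℝ, |t| ≤ T → ‖u x t‖ * (1 + x ^ 2) ≤ C ∧
      ‖u1 x t‖ * (1 + x ^ 2) ≤ C ∧ ‖u2 x t‖ * (1 + x ^ 2) ≤ C) (a k t : ℝ) :
    wigner ε (fun x' => u x' t) (fun x' => u x' t) (a + 2 * π * k * t) k =
      wigner ε (fun x' => u x' 0) (fun x' => u x' 0) a k := by
  have hc0 : ∀ t, Continuous (fun x' => u x' t) := fun t =>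
    continuous_iff_continuousAt.2 fun x => (hx x t).continuousAt
  have hc1 : ∀ t, Continuous (fun x' => u1 x' t) := fun t =>
    continuous_iff_continuousAt.2 fun x => (hx1 x t).continuousAt
  let D : ℝ → ℝ → ℂ := fun s y =>
    (2 * π * k : ℂ) * (bt ε k (fun x => u1 x s) (fun x => u x s) (a + 2 * π * k * s) y
      + bt ε k (fun x => u x s) (fun x => u1 x s) (a + 2 * π * k * s) y)
    + Complex.I * ε / 2 * (bt ε k (fun x => u2 x s) (fun x => u x s) (a + 2 * π * k * s) y
      - bt ε k (fun x => u x s) (fun x => u2 x s) (a + 2 * π * k * s) y)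
  have hderiv : ∀ s, HasDerivAt (fun s => ∫ y, bt ε k (fun x => u x s) (fun x => u x s) (a + 2 * π * k * s) y)
      (∫ y, D s y) s := by
    intro s₀
    obtain ⟨C, hC⟩ := hb (|s₀| + 1)
    have hs : ∀ s ∈ Metric.ball s₀ 1, |s| ≤ |s₀| + 1 := by
      intro s hs
      rw [Metric.mem_ball, Real.dist_eq] at hs
      have := abs_add_le (s - s₀) s₀
      rw [sub_add_cancel] at this
      linarith
    have hs0 : |s₀| ≤ |s₀| + 1 := by linarith
    refine (hasDerivAt_integral_of_dominated_loc_of_deriv_le (s := Metric.ball s₀ 1)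
      (F := fun s y => bt ε k (fun x => u x s) (fun x => u x s) (a + 2 * π * k * s) y) (F' := D) (μ := volume)
      (bound := fun y => (‖(2 * π * k : ℂ)‖ * 2 + ‖Complex.I * ε / 2‖ * 2) *
        (2 * C ^ 2 * (1 + (ε * y) ^ 2)⁻¹))
      (Metric.ball_mem_nhds s₀ one_pos) ?_ ?_ ?_ ?_ ?_ ?_).2
    · exact Filter.Eventually.of_forall fun s =>
        (bt_cont (fun x => u x s) (fun x => u x s) (hc0 s) (hc0 s) ε _ k).aestronglyMeasurable
    · exact bt_int (fun x => u x s₀) (fun x => u x s₀) ε _ k hε (hc0 s₀) (hc0 s₀) (fun x => (hC s₀ x hs0).1)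
        (fun x => (hC s₀ x hs0).1)
    · refine Continuous.aestronglyMeasurable ?_
      exact (continuous_const.mul ((bt_cont (fun x => u1 x s₀) (fun x => u x s₀) (hc1 s₀) (hc0 s₀) ε _ k).add
        (bt_cont (fun x => u x s₀) (fun x => u1 x s₀) (hc0 s₀) (hc1 s₀) ε _ k))).add (continuous_const.mul
        ((bt_cont (fun x => u2 x s₀) (fun x => u x s₀) (hc2 s₀) (hc0 s₀) ε _ k).sub (bt_cont (fun x => u x s₀) (fun x => u2 x s₀) (hc0 s₀) (hc2 s₀) ε _ k)))
    · refine Filter.Eventually.of_forall fun y s hsb => ?_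
      have h := hs s hsb
      have b1 := bt_bound (fun x => u1 x s) (fun x => u x s) ε (a + 2 * π * k * s) y k (fun x => (hC s x h).2.1)
        (fun x => (hC s x h).1)
      have b2 := bt_bound (fun x => u x s) (fun x => u1 x s) ε (a + 2 * π * k * s) y k (fun x => (hC s x h).1)
        (fun x => (hC s x h).2.1)
      have b3 := bt_bound (fun x => u2 x s) (fun x => u x s) ε (a + 2 * π * k * s) y k (fun x => (hC s x h).2.2)
        (fun x => (hC s x h).1)
      have b4 := bt_bound (fun x => u x s) (fun x => u2 x s) ε (a + 2 * π * k * s) y k (fun x => (hC s x h).1)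
        (fun x => (hC s x h).2.2)
      refine (norm_add_le _ _).trans ?_
      rw [norm_mul (2 * π * k : ℂ), norm_mul (Complex.I * ε / 2), add_mul, mul_assoc ‖(2 * π * k : ℂ)‖,
        mul_assoc ‖Complex.I * ε / 2‖]
      refine add_le_add (mul_le_mul_of_nonneg_left ?_ (norm_nonneg _))
        (mul_le_mul_of_nonneg_left ?_ (norm_nonneg _))
      · refine (norm_add_le _ _).trans ?_
        linarith [add_le_add b1 b2]
      · refine (norm_sub_le _ _).trans ?_
        linarith [add_le_add b3 b4]
    · exact ((integrable_bd ε hε).const_mul (2 * C ^ 2)).const_mul _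
    · refine Filter.Eventually.of_forall fun y s _ => ?_
      have h1 := ht (a + ε * y / 2) (2 * π * k) s
      have h2 := (ht (a - ε * y / 2) (2 * π * k) s).star
      have h3 := (h1.const_mul (Complex.exp (-(2 * π * Complex.I * k * y)))).mul h2
      have e1 : ∀ s, a + ε * y / 2 + 2 * π * k * s = a + 2 * π * k * s + ε * y / 2 :=
        fun s => by ring
      have e2 : ∀ s, a - ε * y / 2 + 2 * π * k * s = a + 2 * π * k * s - ε * y / 2 :=
        fun s => by ring
      simp only [e1, e2] at h3
      refine HasDerivAt.congr_deriv h3 ?_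
      simp only [D, bt, Complex.star_def, map_add, map_mul, map_div₀,
        Complex.conj_I, Complex.conj_ofReal, map_ofNat]
      push_cast
      ring
  have hzero : ∀ s, ∫ y, D s y = 0 := by
    intro s
    obtain ⟨C, hC⟩ := hb |s|
    have H := fun x => hC s x le_rfl
    have I1 := bt_int (fun x => u1 x s) (fun x => u x s) ε (a + 2 * π * k * s) k hε (hc1 s) (hc0 s) (fun x => (H x).2.1)
      (fun x => (H x).1)
    have I2 := bt_int (fun x => u x s) (fun x => u1 x s) ε (a + 2 * π * k * s) k hε (hc0 s) (hc1 s) (fun x => (H x).1)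
      (fun x => (H x).2.1)
    have I3 := bt_int (fun x => u2 x s) (fun x => u x s) ε (a + 2 * π * k * s) k hε (hc2 s) (hc0 s) (fun x => (H x).2.2)
      (fun x => (H x).1)
    have I4 := bt_int (fun x => u x s) (fun x => u2 x s) ε (a + 2 * π * k * s) k hε (hc0 s) (hc2 s) (fun x => (H x).1)
      (fun x => (H x).2.2)
    refine integral_eq_zero_of_hasDerivAt_of_integrable
      (f := fun y => Complex.I * (bt ε k (fun x => u1 x s) (fun x => u x s) (a + 2 * π * k * s) y
      + bt ε k (fun x => u x s) (fun x => u1 x s) (a + 2 * π * k * s) y)) ?_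
      (((I1.add I2).const_mul _).add ((I3.sub I4).const_mul _)) ((I1.add I2).const_mul _)
    intro y
    have q1 : HasDerivAt (fun y : ℝ => a + 2 * π * k * s + ε * y / 2) (ε / 2) y := by
      simpa using (((hasDerivAt_id y).const_mul ε).div_const 2).const_add (a + 2 * π * k * s)
    have q2 : HasDerivAt (fun y : ℝ => a + 2 * π * k * s - ε * y / 2) (-(ε / 2)) y := by
      simpa using (((hasDerivAt_id y).const_mul ε).div_const 2).const_sub (a + 2 * π * k * s)
    have p : HasDerivAt (fun y : ℝ => Complex.exp (-(2 * π * Complex.I * k * y)))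
        (Complex.exp (-(2 * π * Complex.I * k * y)) * -(2 * π * Complex.I * k)) y := by
      have := (((hasDerivAt_id y).ofReal_comp.const_mul (2 * π * Complex.I * k)).neg).cexp
      simpa using this
    have a0 := (hx (a + 2 * π * k * s + ε * y / 2) s).scomp y q1
    have a1 := (hx1 (a + 2 * π * k * s + ε * y / 2) s).scomp y q1
    have b0 := ((hx (a + 2 * π * k * s - ε * y / 2) s).scomp y q2).star
    have b1 := ((hx1 (a + 2 * π * k * s - ε * y / 2) s).scomp y q2).star
    have key := (((p.mul a1).mul b0).add ((p.mul a0).mul b1)).const_mul Complex.I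
    refine HasDerivAt.congr_deriv key ?_
    simp only [D, bt, Complex.real_smul, map_mul, Function.comp, Complex.star_def,
        Complex.conj_ofReal, Pi.mul_apply]
    push_cast
    linear_combination (- 2 * π * k * (Complex.exp (-(2 * π * Complex.I * k * y)) * (u1 (a + 2 * π * k * s + ε * y / 2) s * (starRingEnd ℂ) (u (a + 2 * π * k * s - ε * y / 2) s) + u (a + 2 * π * k * s + ε * y / 2) s * (starRingEnd ℂ) (u1 (a + 2 * π * k * s - ε * y / 2) s)))) * Complex.I_sq
  have hconst := is_const_of_deriv_eq_zero (fun s => (hderiv s).differentiableAt)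
    (fun s => (hderiv s).deriv.trans (hzero s)) t 0
  simpa [wigner, bt] using hconst

lemma gauss_int (ε σ c : ℝ) (hε : 0 < ε) (hσ : 0 < σ) :
    Integrable (fun x : ℝ => Real.exp (-(2 * π * (c - x) ^ 2 / (ε * σ ^ 2)))) := by
  have h := (integrable_exp_neg_mul_sq (b := 2 * π / (ε * σ ^ 2)) (by positivity)).comp_sub_left c
  refine h.congr (Filter.Eventually.of_forall fun x => ?_)
  simp only
  congr 1
  ring

lemma gKer_int (ε σx σk c k : ℝ) (hε : 0 < ε) (hσx : 0 < σx) (hσk : 0 < σk) :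
    Integrable (fun p : ℝ × ℝ => (gKer ε σx σk (c - p.1) (k - p.2) : ℂ)) := by
  have h := (((gauss_int ε σx c hε hσx).mul_prod (gauss_int ε σk k hε hσk)).const_mul
    (2 / (ε * σx * σk))).ofReal (𝕜 := ℂ)
  refine h.congr (Filter.Eventually.of_forall fun x => ?_)
  simp only [gKer]
  rw [← Real.exp_add, ← sub_eq_add_neg]
  rfl

lemma shear_swap (Φ : ℝ → ℝ → ℂ) (c : ℝ) (hm : StronglyMeasurable (fun p : ℝ × ℝ => Φ p.1 p.2))
    (hi : Integrable (fun p : ℝ × ℝ => Φ p.1 p.2)) :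
    ∫ x, ∫ y, Φ x y = ∫ z, ∫ y, Φ (z - c * y) y := by
  have hi' : Integrable (fun p : ℝ × ℝ => Φ (p.1 - c * p.2) p.2) (volume.prod volume) := by
    have hm' : StronglyMeasurable (fun p : ℝ × ℝ => Φ (p.1 - c * p.2) p.2) :=
      hm.comp_measurable (g := fun p : ℝ × ℝ => (p.1 - c * p.2, p.2)) (by fun_prop)
    have hi2 := (integrable_prod_iff' (μ := volume) (ν := volume) hm.aestronglyMeasurable).1 hi
    refine (integrable_prod_iff' hm'.aestronglyMeasurable).2 ⟨?_, ?_⟩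
    · filter_upwards [hi2.1] with y hy using hy.comp_sub_right (c * y)
    · refine hi2.2.congr (Filter.Eventually.of_forall fun y => ?_)
      exact (integral_sub_right_eq_self (fun x => ‖Φ x y‖) (c * y)).symm
  rw [integral_integral_swap hi, integral_integral_swap (f := fun z y => Φ (z - c * y) y) hi']
  congr 1
  ext y
  exact (integral_sub_right_eq_self (fun x => Φ x y) (c * y)).symm

/-- Time-dependent-kernel representation of the Liouville-evolved SWT, free case: if `u` solves
the free Schrödinger equation `ε ∂_t u = i(ε²/2) ∂²_x u` with Schwartz initial datum `u₀`, then
the solution `w̃(x,k,t) = W̃^{σx,σk;ε}[u₀](x - 2πkt, k)` of the free Liouville equation with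
initial data `W̃^{σx,σk;ε}[u₀]` equals the Wigner transform of the true solution at time `t`,
smoothed with the kernel `G_ε` composed with the free Hamiltonian flow
`φ_t(x,k) = (x - 2πkt, k)`. -/
theorem swt_liouville_kernel_repr (ε σx σk : ℝ) (hε : 0 < ε) (hσx : 0 < σx) (hσk : 0 < σk)
    (u₀ : SchwartzMap ℝ ℂ) (u : ℝ → ℝ → ℂ)
    (hu_smooth : ContDiff ℝ (⊤ : ℕ∞) (fun p : ℝ × ℝ => u p.1 p.2))
    (hu_schwartz : ∀ n m : ℕ, ∀ T : ℝ, ∃ C : ℝ, ∀ t x : ℝ, |t| ≤ T →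
      |x| ^ n * ‖iteratedDeriv m (fun x' => u x' t) x‖ ≤ C)
    (hut_schwartz : ∀ n m : ℕ, ∀ T : ℝ, ∃ C : ℝ, ∀ t x : ℝ, |t| ≤ T →
      |x| ^ n * ‖iteratedDeriv m (fun x' => deriv (fun s => u x' s) t) x‖ ≤ C)
    (heq : ∀ x t : ℝ, (ε : ℂ) * deriv (fun s => u x s) t =
      Complex.I * ε ^ 2 / 2 * iteratedDeriv 2 (fun x' => u x' t) x)
    (h0 : ∀ x : ℝ, u x 0 = u₀ x) :
    ∀ x k t : ℝ,
      swt ε σx σk (⇑u₀) (⇑u₀) (x - 2 * π * k * t) k =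
        ∫ z : ℝ, ∫ y : ℝ,
          (gKer ε σx σk ((x - z) - 2 * π * (k - y) * t) (k - y) : ℂ) *
            wigner ε (fun x' => u x' t) (fun x' => u x' t) z y := by
  have hUd : Differentiable ℝ (fun p : ℝ × ℝ => u p.1 p.2) :=
    hu_smooth.differentiable (by simp)
  have hslice : ∀ t, ContDiff ℝ (⊤ : ℕ∞) (fun x' => u x' t) := fun t =>
    hu_smooth.comp (contDiff_id.prodMk contDiff_const)
  have hx : ∀ x t, HasDerivAt (fun x' => u x' t) (iteratedDeriv 1 (fun x' => u x' t) x) x := by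
    intro x t
    rw [iteratedDeriv_one]
    exact ((hslice t).differentiable (by simp) x).hasDerivAt
  have hx1 : ∀ x t, HasDerivAt (fun x'' => iteratedDeriv 1 (fun x' => u x' t) x'')
      (iteratedDeriv 2 (fun x' => u x' t) x) x := by
    intro x t
    rw [iteratedDeriv_succ (n := 1)]
    exact ((hslice t).differentiable_iteratedDeriv 1
      (by exact_mod_cast ENat.natCast_lt_top 1) x).hasDerivAt
  have hc2 : ∀ t, Continuous (fun x'' => iteratedDeriv 2 (fun x' => u x' t) x'') := fun t =>
    (hslice t).continuous_iteratedDeriv 2 (by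
      have := (ENat.natCast_lt_top 2).le
      exact WithTop.coe_le_coe.2 this)
  have hεC : (ε : ℂ) ≠ 0 := by exact_mod_cast hε.ne'
  have ht : ∀ a b s : ℝ, HasDerivAt (fun s => u (a + b * s) s)
      (b * iteratedDeriv 1 (fun x' => u x' s) (a + b * s) +
        Complex.I * ε / 2 * iteratedDeriv 2 (fun x' => u x' s) (a + b * s)) s := by
    intro a b s
    have hF := (hUd (a + b * s, s)).hasFDerivAt
    set L := fderiv ℝ (fun p : ℝ × ℝ => u p.1 p.2) (a + b * s, s) with hL
    have g1 : HasDerivAt (fun s : ℝ => (a + b * s, s)) (b, 1) s := by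
      have : HasDerivAt (fun s : ℝ => a + b * s) b s := by
        simpa using ((hasDerivAt_id s).const_mul b).const_add a
      exact this.prodMk (hasDerivAt_id s)
    have g2 : HasDerivAt (fun x' : ℝ => (x', s)) (1, 0) (a + b * s) :=
      (hasDerivAt_id _).prodMk (hasDerivAt_const _ _)
    have g3 : HasDerivAt (fun s' : ℝ => (a + b * s, s')) (0, 1) s :=
      (hasDerivAt_const _ _).prodMk (hasDerivAt_id _)
    have k1 : HasDerivAt (fun s => u (a + b * s) s) (L (b, 1)) s :=
      hF.comp_hasDerivAt (f := fun s : ℝ => (a + b * s, s)) s g1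
    have k2 : HasDerivAt (fun x' => u x' s) (L (1, 0)) (a + b * s) :=
      hF.comp_hasDerivAt (f := fun x' : ℝ => (x', s)) (a + b * s) g2
    have k3 : HasDerivAt (fun s' => u (a + b * s) s') (L (0, 1)) s :=
      hF.comp_hasDerivAt (f := fun s' : ℝ => (a + b * s, s')) s g3
    convert k1 using 1
    have hsplit : ((b, 1) : ℝ × ℝ) = b • (1, 0) + (0, 1) := by simp
    have hE := heq (a + b * s) s
    rw [k3.deriv] at hE
    rw [hsplit, map_add, map_smul, k2.unique (hx (a + b * s) s), Complex.real_smul]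
    congr 1
    apply mul_left_cancel₀ hεC
    rw [hE]
    ring
  have hb1 : ∀ m : ℕ, ∀ T : ℝ, ∃ C : ℝ, ∀ t x : ℝ, |t| ≤ T →
      ‖iteratedDeriv m (fun x' => u x' t) x‖ * (1 + x ^ 2) ≤ C := by
    intro m T
    obtain ⟨C0, h0⟩ := hu_schwartz 0 m T
    obtain ⟨C2, h2⟩ := hu_schwartz 2 m T
    refine ⟨C0 + C2, fun t x h => ?_⟩
    have e0 := h0 t x h
    have e2 := h2 t x h
    rw [sq_abs] at e2
    rw [pow_zero, one_mul] at e0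
    linarith
  have hb : ∀ T : ℝ, ∃ C : ℝ, ∀ t x : ℝ, |t| ≤ T → ‖u x t‖ * (1 + x ^ 2) ≤ C ∧
      ‖iteratedDeriv 1 (fun x' => u x' t) x‖ * (1 + x ^ 2) ≤ C ∧
      ‖iteratedDeriv 2 (fun x' => u x' t) x‖ * (1 + x ^ 2) ≤ C := by
    intro T
    obtain ⟨C0, h0⟩ := hb1 0 T
    obtain ⟨C1, h1⟩ := hb1 1 T
    obtain ⟨C2, h2⟩ := hb1 2 T
    simp only [iteratedDeriv_zero] at h0
    refine ⟨max C0 (max C1 C2), fun t x h => ⟨(h0 t x h).trans (by simp),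
      (h1 t x h).trans (by simp), (h2 t x h).trans (by simp)⟩⟩
  intro x k t
  have hu0 : (fun x' => u x' 0) = ⇑u₀ := funext h0
  have hW : ∀ z y, wigner ε (fun x' => u x' t) (fun x' => u x' t) z y =
      wigner ε u₀ u₀ (z - 2 * π * t * y) y := by
    intro z y
    have := wigner_transport ε hε u (fun x t => iteratedDeriv 1 (fun x' => u x' t) x)
      (fun x t => iteratedDeriv 2 (fun x' => u x' t) x) hx hx1 hc2 ht hb (z - 2 * π * t * y) y t
    rw [hu0] at this
    rw [← this]
    congr 1
    ring
  obtain ⟨C, hC⟩ := hb 0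
  have hC0 : ∀ x, ‖u₀ x‖ * (1 + x ^ 2) ≤ C := fun x => by
    rw [← h0]; exact (hC 0 x (by simp)).1
  have hWm := wigner_meas ε u₀.continuous u₀.continuous
  have hGi := gKer_int ε σx σk (x - 2 * π * k * t) k hε hσx hσk
  have hGm : StronglyMeasurable (fun p : ℝ × ℝ =>
      (gKer ε σx σk (x - 2 * π * k * t - p.1) (k - p.2) : ℂ)) := by
    refine Continuous.stronglyMeasurable ?_
    unfold gKer
    fun_prop
  have hΦi : Integrable (fun p : ℝ × ℝ =>
      (gKer ε σx σk (x - 2 * π * k * t - p.1) (k - p.2) : ℂ) * wigner ε u₀ u₀ p.1 p.2) :=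
    hGi.mul_bdd hWm.aestronglyMeasurable
      (Filter.Eventually.of_forall fun p => wigner_bound ε p.1 p.2 hε hC0 hC0)
  unfold swt
  rw [shear_swap (fun a b => (gKer ε σx σk (x - 2 * π * k * t - a) (k - b) : ℂ) *
    wigner ε u₀ u₀ a b) (2 * π * t) (hGm.mul hWm) hΦi]
  simp only [hW]
  congr 1
  ext z
  congr 1
  ext y
  congr 3
  ring
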